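/- arXiv:1606.08805 — 3 statements merged into one kernel-verified Lean document; each statement's English description precedes it below -/
import Mathlib

section
/- (Lemma 1 of the paper.) Let G be a finite additive commutative group, n H : ℕ, and T : G → Matrix (Fin n) (Fin n) ℝ satisfy T 0 = 1, T (g + g') = T g * T g' for all g, g', and (T g) * (T g)ᵀ = 1 for all g. Let W, D : ℕ → G → Matrix (Fin H) (Fin n) ℝ, η : ℝ, and α : ℕ → ℝ be such that: (initialisation) there exists M : Matrix (Fin H) (Fin n) ℝ with W 0 g = M * (T g)ᵀ for all g ∈ G; (gradient sharing) for every t ∈ ℕ and all g, g' ∈ G, D t g' = D t g * (T (g' - g))ᵀ; (update rule) for every t ∈ ℕ and g ∈ G, W (t+1) g = W t g + η • D (t+1) g + (α (t+1)) • D t g. Then for every t ∈ ℕ and all g, g' ∈ G, W t g' = W t g * (T (g' - g))ᵀ. -/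
open Matrix

/-- Lemma 1 of the paper: under the θ-RBM training procedure (rotated
initialisation, rotated gradient slices, contrastive-divergence update with
learning rate `η` and momentum `α`), every iterate of the weight tensor
satisfies rotational weight-sharing. -/
theorem theta_rbm_weight_sharing
    (G : Type*) [AddCommGroup G] [Fintype G] (n H : ℕ)
    (T : G → Matrix (Fin n) (Fin n) ℝ)
    (hT0 : T 0 = 1)
    (hTadd : ∀ g g' : G, T (g + g') = T g * T g')
    (hTorth : ∀ g : G, T g * (T g)ᵀ = 1)
    (W D : ℕ → G → Matrix (Fin H) (Fin n) ℝ)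
    (η : ℝ) (α : ℕ → ℝ)
    (hInit : ∃ M : Matrix (Fin H) (Fin n) ℝ, ∀ g : G, W 0 g = M * (T g)ᵀ)
    (hGrad : ∀ (t : ℕ) (g g' : G), D t g' = D t g * (T (g' - g))ᵀ)
    (hUpdate : ∀ (t : ℕ) (g : G),
      W (t + 1) g = W t g + η • D (t + 1) g + (α (t + 1)) • D t g) :
    ∀ (t : ℕ) (g g' : G), W t g' = W t g * (T (g' - g))ᵀ := by
  intro t
  induction t with
  | zero =>
    intro g g'
    obtain ⟨M, hM⟩ := hInit
    rw [hM, hM, Matrix.mul_assoc, ← Matrix.transpose_mul, ← hTadd, sub_add_cancel]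
  | succ t ih =>
    intro g g'
    rw [hUpdate t g', hUpdate t g, ih g g', hGrad (t + 1) g g', hGrad t g g',
      Matrix.add_mul, Matrix.add_mul, Matrix.smul_mul, Matrix.smul_mul]
end

section
/- Fix V H S : ℕ, a weight tensor W : Fin H → Fin V → Fin S → ℝ, and biases b : Fin H → ℝ, c : Fin V → ℝ. For binary configurations v : Fin V → Bool, h : Fin H → Bool and a real vector r : Fin S → ℝ, define the energy E v h r = ∑ s, r s * ( - (∑ j, ∑ k, (if v k then (1:ℝ) else 0) * (if h j then (1:ℝ) else 0) * W j k s) - (∑ j, b j * (if h j then (1:ℝ) else 0)) - (∑ k, c k * (if v k then (1:ℝ) else 0)) ). Then for every v : Fin V → Bool, r : Fin S → ℝ, and j : Fin H, (∑ h ∈ {h : Fin H → Bool | h j = true}, Real.exp (-(E v h r))) / (∑ h : Fin H → Bool, Real.exp (-(E v h r))) = σ (∑ s, r s * (b j + ∑ k, W j k s * (if v k then (1:ℝ) else 0))), where σ y = 1 / (1 + Real.exp (-y)). -/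
/-- Equation (3) of the paper: under the Gibbs distribution of the gated
θ-RBM energy, the conditional probability that hidden unit `j` is on given
the visible layer `v` and rotation layer `r` is the logistic sigmoid of
`∑ s, r s * (b j + W_{j,•,s} · v)`. -/
theorem theta_rbm_conditional_hidden
    (V H S : ℕ)
    (W : Fin H → Fin V → Fin S → ℝ)
    (b : Fin H → ℝ) (c : Fin V → ℝ)
    (E : (Fin V → Bool) → (Fin H → Bool) → (Fin S → ℝ) → ℝ)
    (hE : ∀ (v : Fin V → Bool) (h : Fin H → Bool) (r : Fin S → ℝ),
      E v h r = ∑ s, r s *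
        ( - (∑ j, ∑ k, (if v k then (1:ℝ) else 0) *
              (if h j then (1:ℝ) else 0) * W j k s)
          - (∑ j, b j * (if h j then (1:ℝ) else 0))
          - (∑ k, c k * (if v k then (1:ℝ) else 0)) ))
    (σ : ℝ → ℝ) (hσ : ∀ y : ℝ, σ y = 1 / (1 + Real.exp (-y))) :
    ∀ (v : Fin V → Bool) (r : Fin S → ℝ) (j : Fin H),
      (∑ h ∈ Finset.univ.filter (fun h : Fin H → Bool => h j = true),
          Real.exp (-(E v h r))) /
        (∑ h : Fin H → Bool, Real.exp (-(E v h r)))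
      = σ (∑ s, r s * (b j + ∑ k, W j k s * (if v k then (1:ℝ) else 0))) := by
  intro v r j
  set a : Fin H → ℝ := fun i =>
    ∑ s, r s * (b i + ∑ k, W i k s * (if v k then (1:ℝ) else 0)) with ha
  -- The energy is affine in the hidden units.
  have hEa : ∀ h : Fin H → Bool, E v h r =
      -(∑ s, r s * ∑ k, c k * (if v k then (1:ℝ) else 0))
        - ∑ i, (if h i then (1:ℝ) else 0) * a i := by
    intro h
    have h1 : ∑ i, (if h i then (1:ℝ) else 0) * a i =
        ∑ s, r s * ((∑ i, ∑ k, (if v k then (1:ℝ) else 0) *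
              (if h i then (1:ℝ) else 0) * W i k s)
          + (∑ i, b i * (if h i then (1:ℝ) else 0))) := by
      simp only [ha, Finset.mul_sum]
      rw [Finset.sum_comm]
      refine Finset.sum_congr rfl fun s _ => ?_
      rw [← Finset.sum_add_distrib, Finset.mul_sum]
      refine Finset.sum_congr rfl fun i _ => ?_
      have h2 : ∑ k, (if v k then (1:ℝ) else 0) * (if h i then (1:ℝ) else 0) * W i k s
          = (if h i then (1:ℝ) else 0) * ∑ k, W i k s * (if v k then (1:ℝ) else 0) := by
        rw [Finset.mul_sum]
        exact Finset.sum_congr rfl fun k _ => by ring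
      rw [h2]
      ring
    rw [hE, h1, ← Finset.sum_neg_distrib, ← Finset.sum_sub_distrib]
    exact Finset.sum_congr rfl fun s _ => by ring
  -- Switching unit `j` off changes the energy by `a j`.
  have hflip : ∀ h : Fin H → Bool, h j = true →
      E v (Function.update h j false) r = E v h r + a j := by
    intro h hj
    rw [hEa, hEa, ← Finset.add_sum_erase _ _ (Finset.mem_univ j),
      ← Finset.add_sum_erase Finset.univ (fun i => (if h i then (1:ℝ) else 0) * a i)
        (Finset.mem_univ j)]
    have h3 : ∑ i ∈ Finset.univ.erase j,
        (if Function.update h j false i then (1:ℝ) else 0) * a i =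
        ∑ i ∈ Finset.univ.erase j, (if h i then (1:ℝ) else 0) * a i := by
      refine Finset.sum_congr rfl fun i hi => ?_
      rw [Function.update_of_ne (Finset.ne_of_mem_erase hi)]
    rw [h3]
    simp [hj]
    ring
  have hoff : ∑ h ∈ Finset.univ.filter (fun h : Fin H → Bool => ¬ h j = true),
        Real.exp (-(E v h r)) =
      (∑ h ∈ Finset.univ.filter (fun h : Fin H → Bool => h j = true),
        Real.exp (-(E v h r))) * Real.exp (-(a j)) := by
    rw [Finset.sum_mul]
    symm
    refine Finset.sum_nbij' (fun h => Function.update h j false)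
      (fun h => Function.update h j true) ?_ ?_ ?_ ?_ ?_
    · intro h _
      simp
    · intro h _
      simp
    · intro h hh
      have hj : h j = true := by simpa using hh
      simp [← hj]
    · intro h hh
      have hj : h j = false := by simpa using hh
      simp [← hj]
    · intro h hh
      have hj : h j = true := by simpa using hh
      rw [hflip h hj, ← Real.exp_add]
      congr 1
      ring
  have hpos : 0 < ∑ h ∈ Finset.univ.filter (fun h : Fin H → Bool => h j = true),
      Real.exp (-(E v h r)) :=
    Finset.sum_pos (fun _ _ => Real.exp_pos _) ⟨fun _ => true, by simp⟩
  rw [← Finset.sum_filter_add_sum_filter_not Finset.univ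
    (fun h : Fin H → Bool => h j = true) (fun h => Real.exp (-(E v h r))), hoff, hσ]
  change _ = 1 / (1 + Real.exp (-(a j)))
  have hexp := Real.exp_pos (-(a j))
  generalize Real.exp (-(a j)) = e at *
  field_simp
end

section
/- Fix V H S : ℕ, a weight tensor W : Fin H → Fin V → Fin S → ℝ, and biases b : Fin H → ℝ, c : Fin V → ℝ. For binary configurations v : Fin V → Bool, h : Fin H → Bool and a real vector r : Fin S → ℝ, define the energy E v h r = ∑ s, r s * ( - (∑ j, ∑ k, (if v k then (1:ℝ) else 0) * (if h j then (1:ℝ) else 0) * W j k s) - (∑ j, b j * (if h j then (1:ℝ) else 0)) - (∑ k, c k * (if v k then (1:ℝ) else 0)) ). Then for every h : Fin H → Bool, r : Fin S → ℝ, and k : Fin V, (∑ v ∈ {v : Fin V → Bool | v k = true}, Real.exp (-(E v h r))) / (∑ v : Fin V → Bool, Real.exp (-(E v h r))) = σ (∑ s, r s * (c k + ∑ j, (if h j then (1:ℝ) else 0) * W j k s)), where σ y = 1 / (1 + Real.exp (-y)). -/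
/-- Equation (4) of the paper: under the Gibbs distribution of the gated
θ-RBM energy, the conditional probability that visible unit `k` is on given
the hidden layer `h` and rotation layer `r` is the logistic sigmoid of
`∑ s, r s * (c k + h' W_{•,k,s})`. -/
theorem theta_rbm_conditional_visible
    (V H S : ℕ)
    (W : Fin H → Fin V → Fin S → ℝ)
    (b : Fin H → ℝ) (c : Fin V → ℝ)
    (E : (Fin V → Bool) → (Fin H → Bool) → (Fin S → ℝ) → ℝ)
    (hE : ∀ (v : Fin V → Bool) (h : Fin H → Bool) (r : Fin S → ℝ),
      E v h r = ∑ s, r s *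
        ( - (∑ j, ∑ k, (if v k then (1:ℝ) else 0) *
              (if h j then (1:ℝ) else 0) * W j k s)
          - (∑ j, b j * (if h j then (1:ℝ) else 0))
          - (∑ k, c k * (if v k then (1:ℝ) else 0)) ))
    (σ : ℝ → ℝ) (hσ : ∀ y : ℝ, σ y = 1 / (1 + Real.exp (-y))) :
    ∀ (h : Fin H → Bool) (r : Fin S → ℝ) (k : Fin V),
      (∑ v ∈ Finset.univ.filter (fun v : Fin V → Bool => v k = true),
          Real.exp (-(E v h r))) /
        (∑ v : Fin V → Bool, Real.exp (-(E v h r)))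
      = σ (∑ s, r s * (c k + ∑ j, (if h j then (1:ℝ) else 0) * W j k s)) := by
  intro h r k
  set X : Fin V → ℝ := fun k => ∑ s, r s * (c k + ∑ j, (if h j then (1:ℝ) else 0) * W j k s)
    with hX
  have hlin : ∀ v : Fin V → Bool, -(E v h r) =
      (∑ s, r s * ∑ j, b j * (if h j then (1:ℝ) else 0))
        + ∑ i, (if v i then (1:ℝ) else 0) * X i := by
    intro v
    have h1 : ∑ i, (if v i then (1:ℝ) else 0) * X i =
        ∑ s, r s * ((∑ j, ∑ k, (if v k then (1:ℝ) else 0) *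
              (if h j then (1:ℝ) else 0) * W j k s)
              + ∑ k, c k * (if v k then (1:ℝ) else 0)) := by
      simp only [hX, Finset.mul_sum]
      rw [Finset.sum_comm]
      refine Finset.sum_congr rfl fun s _ => ?_
      rw [Finset.sum_comm (s := (Finset.univ : Finset (Fin H))), ← Finset.sum_add_distrib,
        Finset.mul_sum]
      refine Finset.sum_congr rfl fun i _ => ?_
      have h2 : ∑ j, (if v i then (1:ℝ) else 0) * (if h j then (1:ℝ) else 0) * W j i s
          = (if v i then (1:ℝ) else 0) * ∑ j, (if h j then (1:ℝ) else 0) * W j i s := by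
        rw [Finset.mul_sum]
        exact Finset.sum_congr rfl fun j _ => mul_assoc _ _ _
      rw [h2]
      ring
    rw [h1, hE, ← Finset.sum_neg_distrib, ← Finset.sum_add_distrib]
    refine Finset.sum_congr rfl fun s _ => ?_
    ring
  have hflip : ∀ v : Fin V → Bool, v k = true →
      Real.exp (-(E (Function.update v k false) h r))
        = Real.exp (-X k) * Real.exp (-(E v h r)) := by
    intro v hv
    rw [← Real.exp_add, hlin, hlin,
      ← Finset.add_sum_erase _ _ (Finset.mem_univ k),
      ← Finset.add_sum_erase (a := k) _ (fun i => (if v i then (1:ℝ) else 0) * X i)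
        (Finset.mem_univ k)]
    have h3 : ∑ i ∈ Finset.univ.erase k,
        (if Function.update v k false i then (1:ℝ) else 0) * X i
        = ∑ i ∈ Finset.univ.erase k, (if v i then (1:ℝ) else 0) * X i := by
      refine Finset.sum_congr rfl fun i hi => ?_
      rw [Function.update_of_ne (Finset.ne_of_mem_erase hi)]
    rw [h3]
    simp [hv]
    ring
  have hfalse : ∑ v ∈ Finset.univ.filter (fun v : Fin V → Bool => ¬ v k = true),
      Real.exp (-(E v h r)) = Real.exp (-X k) *
      ∑ v ∈ Finset.univ.filter (fun v : Fin V → Bool => v k = true),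
          Real.exp (-(E v h r)) := by
    rw [Finset.mul_sum]
    symm
    refine Finset.sum_bij' (fun v _ => Function.update v k false)
      (fun v _ => Function.update v k true) ?_ ?_ ?_ ?_ ?_
    · intro v _
      simp
    · intro v _
      simp
    · intro v hv
      have hv' : v k = true := by simpa using hv
      simp [← hv']
    · intro v hv
      have hv' : v k = false := by simpa using hv
      simp [← hv']
    · intro v hv
      exact (hflip v (by simpa using hv)).symm
  have hpos : 0 < ∑ v ∈ Finset.univ.filter (fun v : Fin V → Bool => v k = true),
      Real.exp (-(E v h r)) :=
    Finset.sum_pos (fun _ _ => Real.exp_pos _) ⟨fun _ => true, by simp⟩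
  change _ = σ (X k)
  rw [← Finset.sum_filter_add_sum_filter_not Finset.univ (fun v : Fin V → Bool => v k = true),
    hfalse, hσ]
  have := Real.exp_pos (-X k)
  rw [div_eq_div_iff (by positivity) (by positivity)]
  ring
end
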